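/- arXiv:2602.06754 — 2 statements merged into one kernel-verified Lean document; each statement's English description precedes it below -/
import Mathlib

section
/- Let Σ be a nonempty finite set, let p ∈ Δ(Σ) have full support, let G = (G_u)_{u∈Σ} be a random vector whose coordinates are i.i.d. from a probability law on ℝ with finite first moment, and let ε ≥ 0. Consider the problem of maximizing E[Σ_{u∈Σ} G_u q(G)_u] over measurable functions q : ℝ^Σ → Δ(Σ) subject to KL(E[q(G)] ‖ p) ≤ ε. Then there exist a vector τ : Σ → ℝ and a measurable tie-breaking function T : ℝ^Σ × Σ → [0,1] with T_u(g) = 0 whenever u ∉ argmax_{v∈Σ}(g_v + τ_v) and Σ_{u ∈ argmax_{v}(g_v+τ_v)} T_u(g) = 1, such that the function q*(g)_u = T_u(g) is an optimal solution; moreover τ and T can be chosen so that KL(E[q*(G)] ‖ p) = ε, unless τ = 0 already yields a feasible solution. -/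
open Finset MeasureTheory

/-- The probability simplex on a finite type `V`. -/
def simplex (V : Type*) [Fintype V] : Set (V → ℝ) :=
  {q | (∀ u, 0 ≤ q u) ∧ ∑ u, q u = 1}

/-- KL divergence `KL(q ‖ p) = ∑ u, q u * log (q u / p u)`
(the convention `0 · log 0 = 0` holds automatically). -/
noncomputable def KL {V : Type*} [Fintype V] (q p : V → ℝ) : ℝ :=
  ∑ u, q u * Real.log (q u / p u)

open Filter Topology

section Divergence

variable {V : Type*} [Fintype V]

theorem continuous_KL {p : V → ℝ} (hppos : ∀ u, 0 < p u) :
    Continuous fun q : V → ℝ => KL q p := by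
  have h : (fun q : V → ℝ => KL q p)
      = fun q => ∑ u, p u * ((q u / p u) * Real.log (q u / p u)) := by
    ext q
    refine Finset.sum_congr rfl fun u _ => ?_
    have := (hppos u).ne'
    field_simp
  rw [h]
  exact continuous_finsetSum _ fun u _ => continuous_const.mul
    (Real.continuous_mul_log.comp ((continuous_apply u).div_const _))

theorem convexOn_KL {p : V → ℝ} (hppos : ∀ u, 0 < p u) :
    ConvexOn ℝ (simplex V) fun q => KL q p := by
  refine ⟨convex_stdSimplex ℝ V, fun x hx y hy a b ha hb hab => ?_⟩
  simp only [KL, smul_eq_mul, Finset.mul_sum, ← Finset.sum_add_distrib]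
  refine Finset.sum_le_sum fun u _ => ?_
  have hpu := hppos u
  have h := Real.convexOn_mul_log.2 (Set.mem_Ici.2 (div_nonneg (hx.1 u) hpu.le))
    (Set.mem_Ici.2 (div_nonneg (hy.1 u) hpu.le)) ha hb hab
  have h2 := mul_le_mul_of_nonneg_left h hpu.le
  simp only [smul_eq_mul] at h2
  have e : a * (x u / p u) + b * (y u / p u) = (a • x + b • y) u / p u := by
    simp only [Pi.add_apply, Pi.smul_apply, smul_eq_mul]; ring
  rw [e] at h2
  calc _ = p u * ((a • x + b • y) u / p u * Real.log ((a • x + b • y) u / p u)) := by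
        field_simp
    _ ≤ _ := h2
    _ = _ := by field_simp

theorem KL_self {p : V → ℝ} (hppos : ∀ u, 0 < p u) : KL p p = 0 :=
  Finset.sum_eq_zero fun u _ => by simp [div_self (hppos u).ne']

/-- The set of distributions within divergence `ε` of `p`. -/
def klBall (p : V → ℝ) (ε : ℝ) : Set (V → ℝ) :=
  {q | q ∈ simplex V ∧ KL q p ≤ ε}

theorem convex_klBall {p : V → ℝ} (hppos : ∀ u, 0 < p u) (ε : ℝ) : Convex ℝ (klBall p ε) :=
  (convexOn_KL hppos).convex_le ε

theorem isCompact_klBall {p : V → ℝ} (hppos : ∀ u, 0 < p u) (ε : ℝ) :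
    IsCompact (klBall p ε) :=
  (isCompact_stdSimplex ℝ V).inter_right
    (isClosed_le (continuous_KL hppos) continuous_const)

theorem le_one_of_mem_simplex {q : V → ℝ} (hq : q ∈ simplex V) (u : V) : q u ≤ 1 :=
  hq.2 ▸ Finset.single_le_sum (fun v _ => hq.1 v) (Finset.mem_univ u)

end Divergence

section Argmax

variable {V : Type*} [Fintype V]

open Classical in
/-- The set of maximizers of `h`. -/
noncomputable def argmaxSet (h : V → ℝ) : Finset V :=
  Finset.univ.filter fun u => ∀ v, h v ≤ h u

theorem mem_argmaxSet {h : V → ℝ} {u : V} : u ∈ argmaxSet h ↔ ∀ v, h v ≤ h u := by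
  simp [argmaxSet]

theorem measurable_comp_argmaxSet {β : Type*} [MeasurableSpace β] (t : Finset V → β) (τ : V → ℝ) :
    Measurable fun g : V → ℝ => t (argmaxSet (g + τ)) := by
  let _ : MeasurableSpace (Finset V) := ⊤
  have h : Measurable fun g : V → ℝ => argmaxSet (g + τ) := by
    refine measurable_to_countable' fun B => ?_
    have e : (fun g : V → ℝ => argmaxSet (g + τ)) ⁻¹' {B}
        = ⋂ u, {g | (∀ v, g v + τ v ≤ g u + τ u) ↔ u ∈ B} := by
      ext g
      simp [Finset.ext_iff, mem_argmaxSet]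
    rw [e]
    refine MeasurableSet.iInter fun u => ?_
    have hm : MeasurableSet {g : V → ℝ | ∀ v, g v + τ v ≤ g u + τ u} := by
      rw [Set.ofPred_forall]
      exact MeasurableSet.iInter fun v => measurableSet_le
        ((measurable_pi_apply v).add_const _) ((measurable_pi_apply u).add_const _)
    by_cases hu : u ∈ B
    · simpa [hu] using hm
    · simp only [hu, iff_false]
      exact hm.compl
  exact (measurable_from_top (f := t)).comp h

variable [Nonempty V]

/-- The largest value of `h`. -/
noncomputable def maxVal (h : V → ℝ) : ℝ := Finset.univ.sup' Finset.univ_nonempty h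

theorem le_maxVal (h : V → ℝ) (u : V) : h u ≤ maxVal h :=
  Finset.le_sup' h (Finset.mem_univ u)

theorem maxVal_le {h : V → ℝ} {c : ℝ} (hc : ∀ u, h u ≤ c) : maxVal h ≤ c :=
  Finset.sup'_le _ _ fun u _ => hc u

theorem exists_eq_maxVal (h : V → ℝ) : ∃ u, h u = maxVal h := by
  obtain ⟨u, -, hu⟩ := Finset.exists_mem_eq_sup' Finset.univ_nonempty h
  exact ⟨u, hu.symm⟩

theorem mem_argmaxSet_iff {h : V → ℝ} {u : V} : u ∈ argmaxSet h ↔ h u = maxVal h := by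
  rw [mem_argmaxSet]
  exact ⟨fun H => le_antisymm (le_maxVal h u) (maxVal_le H), fun H v => H ▸ le_maxVal h v⟩

theorem argmaxSet_nonempty (h : V → ℝ) : (argmaxSet h).Nonempty :=
  (exists_eq_maxVal h).imp fun _ => mem_argmaxSet_iff.2

theorem maxVal_le_add (h d : V → ℝ) : maxVal (h + d) ≤ maxVal h + ‖d‖ :=
  maxVal_le fun u => add_le_add (le_maxVal h u) ((le_abs_self _).trans (norm_le_pi_norm d u))

theorem abs_maxVal_add_sub_le (h d : V → ℝ) : |maxVal (h + d) - maxVal h| ≤ ‖d‖ := by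
  have h1 := maxVal_le_add h d
  have h2 := maxVal_le_add (h + d) (-d)
  simp only [add_neg_cancel_right, norm_neg] at h2
  rw [abs_le]; constructor <;> linarith

theorem measurable_maxVal : Measurable (maxVal : (V → ℝ) → ℝ) := by
  have := Finset.measurable_sup' (s := (Finset.univ : Finset V)) Finset.univ_nonempty
    (f := fun u (h : V → ℝ) => h u) fun u _ => measurable_pi_apply u
  convert this using 1
  ext h
  simp [maxVal, Finset.sup'_apply]

theorem abs_maxVal_le (h : V → ℝ) : |maxVal h| ≤ ∑ u, |h u| := by
  obtain ⟨u, hu⟩ := exists_eq_maxVal h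
  rw [← hu]
  exact Finset.single_le_sum (f := fun v => |h v|) (fun v _ => abs_nonneg _) (Finset.mem_univ u)

/-- For small steps `s`, the maximum of `h + s • d` grows at the rate of the best direction
among the current maximizers. -/
theorem eventually_maxVal_add_smul (h d : V → ℝ) {k : V} (hk : k ∈ argmaxSet h)
    (hkd : ∀ u ∈ argmaxSet h, d u ≤ d k) :
    ∀ᶠ s : ℝ in 𝓝[>] 0, maxVal (h + s • d) = maxVal h + s * d k := by
  have key : ∀ u, ∀ᶠ s : ℝ in 𝓝[>] 0, h u + s * d u ≤ maxVal h + s * d k := by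
    intro u
    by_cases hu : u ∈ argmaxSet h
    · filter_upwards [self_mem_nhdsWithin] with s hs
      exact add_le_add (le_maxVal h u) (mul_le_mul_of_nonneg_left (hkd u hu) (le_of_lt hs))
    · have hlt : h u < maxVal h :=
        lt_of_le_of_ne (le_maxVal h u) fun e => hu (mem_argmaxSet_iff.2 e)
      refine nhdsWithin_le_nhds ?_
      have h1 : Tendsto (fun s : ℝ => h u + s * d u) (𝓝 0) (𝓝 (h u)) := by
        have : Continuous fun s : ℝ => h u + s * d u := by fun_prop
        simpa using this.tendsto 0
      have h2 : Tendsto (fun s : ℝ => maxVal h + s * d k) (𝓝 0) (𝓝 (maxVal h)) := by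
        have : Continuous fun s : ℝ => maxVal h + s * d k := by fun_prop
        simpa using this.tendsto 0
      filter_upwards [h1.eventually_lt h2 hlt] with s hs using hs.le
  filter_upwards [eventually_all.2 key] with s hs
  refine le_antisymm (maxVal_le fun u => by simpa using hs u) ?_
  have := le_maxVal (h + s • d) k
  rw [← mem_argmaxSet_iff.1 hk]
  simpa using this

end Argmax

section TieBreaking

variable {V : Type*} [Fintype V] {Ω : Type*} [MeasurableSpace Ω]

/-- Tie-breaking rules: a distribution for each set of maximizers, supported on that set. -/
def tieRules (V : Type*) [Fintype V] : Set (Finset V → V → ℝ) :=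
  Set.univ.pi fun A => {q | q ∈ simplex V ∧ ∀ u, A.Nonempty → u ∉ A → q u = 0}

/-- The expected sampling distribution of the tie-breaking rule `t` with shifts `τ`. -/
noncomputable def meanShare (μ : Measure Ω) (X : Ω → V → ℝ) (τ : V → ℝ)
    (t : Finset V → V → ℝ) : V → ℝ :=
  fun u => ∫ ω, t (argmaxSet (X ω + τ)) u ∂μ

theorem isCompact_tieRules : IsCompact (tieRules V) := by
  refine isCompact_univ_pi fun A => (isCompact_stdSimplex ℝ V).inter_right ?_
  have h : IsClosed {q : V → ℝ | ∀ u, A.Nonempty → u ∉ A → q u = 0} := by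
    simp only [Set.ofPred_forall]
    exact isClosed_iInter fun u => isClosed_iInter fun _ => isClosed_iInter fun _ =>
      isClosed_eq (continuous_apply u) continuous_const
  exact h

theorem convex_tieRules : Convex ℝ (tieRules V) := by
  refine convex_pi fun A _ => (convex_stdSimplex ℝ V).inter ?_
  intro x hx y hy a b _ _ _ u hA hu
  simp [hx u hA hu, hy u hA hu]

theorem mem_simplex_of_mem_tieRules {t : Finset V → V → ℝ} (ht : t ∈ tieRules V)
    (A : Finset V) : t A ∈ simplex V :=
  (ht A trivial).1

theorem pi_single_mem_tieRules [DecidableEq V] {k : Finset V → V}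
    (hk : ∀ A : Finset V, A.Nonempty → k A ∈ A) :
    (fun A => Pi.single (k A) (1 : ℝ)) ∈ tieRules V := by
  refine fun A _ => ⟨single_mem_stdSimplex ℝ (k A), fun u hA hu => ?_⟩
  have : u ≠ k A := fun e => hu (e ▸ hk A hA)
  simp [this]

variable {μ : Measure Ω} {X : Ω → V → ℝ}

theorem meanShare_eq_sum [IsFiniteMeasure μ] (hX : Measurable X) (τ : V → ℝ)
    (t : Finset V → V → ℝ) :
    meanShare μ X τ t
      = fun u => ∑ A, μ.real {ω | argmaxSet (X ω + τ) = A} * t A u := by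
  classical
  ext u
  have hm : ∀ A, MeasurableSet {ω | argmaxSet (X ω + τ) = A} := fun A =>
    (measurable_comp_argmaxSet (fun B => B = A) τ).comp hX (MeasurableSet.of_discrete (s := {True}))
      |> fun h => by convert h using 1; ext ω; simp
  have e : ∀ ω, t (argmaxSet (X ω + τ)) u
      = ∑ A, Set.indicator {ω | argmaxSet (X ω + τ) = A} (fun _ => t A u) ω := by
    intro ω
    simp [Set.indicator_apply]
  simp only [meanShare, e]
  rw [integral_finsetSum _ fun A _ => (integrable_const _).indicator (hm A)]
  refine Finset.sum_congr rfl fun A _ => ?_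
  rw [integral_indicator_const _ (hm A), smul_eq_mul]

theorem isCompact_image_meanShare [IsFiniteMeasure μ] (hX : Measurable X) (τ : V → ℝ) :
    IsCompact (meanShare μ X τ '' tieRules V) := by
  refine isCompact_tieRules.image ?_
  rw [funext (meanShare_eq_sum hX τ)]
  fun_prop

theorem convex_image_meanShare [IsFiniteMeasure μ] (hX : Measurable X) (τ : V → ℝ) :
    Convex ℝ (meanShare μ X τ '' tieRules V) := by
  refine convex_tieRules.is_linear_image ?_
  rw [funext (meanShare_eq_sum hX τ)]
  refine ⟨fun s t => ?_, fun c t => ?_⟩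
  · ext u
    simp [mul_add, Finset.sum_add_distrib]
  · ext u
    simp [Finset.mul_sum, mul_left_comm]

theorem integral_mem_simplex [IsProbabilityMeasure μ] {q : Ω → V → ℝ} (hq : Measurable q)
    (hs : ∀ ω, q ω ∈ simplex V) :
    (∀ u, Integrable (fun ω => q ω u) μ) ∧ (fun u => ∫ ω, q ω u ∂μ) ∈ simplex V := by
  have hint : ∀ u, Integrable (fun ω => q ω u) μ := fun u =>
    Integrable.of_bound ((measurable_pi_apply u).comp hq).aestronglyMeasurable 1
      (ae_of_all _ fun ω => by
        rw [Real.norm_of_nonneg ((hs ω).1 u)]; exact le_one_of_mem_simplex (hs ω) u)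
  refine ⟨hint, fun u => integral_nonneg fun ω => (hs ω).1 u, ?_⟩
  rw [← integral_finsetSum _ fun u _ => hint u]
  simp [(hs _).2]

end TieBreaking

section ExpectedMaximum

variable {V : Type*} [Fintype V] [Nonempty V] {Ω : Type*} [MeasurableSpace Ω]

/-- The expected maximum of `X + τ`. -/
noncomputable def expMax (μ : Measure Ω) (X : Ω → V → ℝ) (τ : V → ℝ) : ℝ :=
  ∫ ω, maxVal (X ω + τ) ∂μ

variable {μ : Measure Ω} [IsProbabilityMeasure μ] {X : Ω → V → ℝ}

theorem integrable_maxVal (hX : Measurable X) (hI : ∀ u, Integrable (fun ω => X ω u) μ)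
    (τ : V → ℝ) : Integrable (fun ω => maxVal (X ω + τ)) μ := by
  refine Integrable.mono' (g := fun ω => ∑ u, |X ω u + τ u|)
    (integrable_finsetSum _ fun u _ => ((hI u).add (integrable_const _)).abs)
    (measurable_maxVal.comp (hX.add_const τ)).aestronglyMeasurable
    (ae_of_all _ fun ω => abs_maxVal_le (X ω + τ))

theorem continuous_expMax (hX : Measurable X) (hI : ∀ u, Integrable (fun ω => X ω u) μ) :
    Continuous (expMax μ X) := by
  refine (LipschitzWith.of_le_add fun τ σ => ?_).continuous
  have h : expMax μ X τ ≤ ∫ ω, (maxVal (X ω + σ) + ‖τ - σ‖) ∂μ := by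
    refine integral_mono (integrable_maxVal hX hI τ)
      ((integrable_maxVal hX hI σ).add (integrable_const _)) fun ω => ?_
    have := maxVal_le_add (X ω + σ) (τ - σ)
    rwa [show X ω + σ + (τ - σ) = X ω + τ by abel] at this
  rw [integral_add (integrable_maxVal hX hI σ) (integrable_const _)] at h
  simpa [dist_eq_norm, expMax] using h

theorem integral_add_le_expMax (hX : Measurable X) (hI : ∀ u, Integrable (fun ω => X ω u) μ)
    (τ : V → ℝ) (u : V) : ∫ ω, X ω u ∂μ + τ u ≤ expMax μ X τ := by
  have h : ∫ ω, (X ω u + τ u) ∂μ ≤ expMax μ X τ :=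
    integral_mono ((hI u).add (integrable_const _)) (integrable_maxVal hX hI τ)
      fun ω => le_maxVal (X ω + τ) u
  rw [integral_add (hI u) (integrable_const _)] at h
  simpa using h

theorem expMax_add_const (hX : Measurable X) (hI : ∀ u, Integrable (fun ω => X ω u) μ)
    (τ : V → ℝ) (c : ℝ) : expMax μ X (τ + fun _ => c) = expMax μ X τ + c := by
  have e : ∀ h : V → ℝ, maxVal (h + fun _ => c) = maxVal h + c := by
    intro h
    refine le_antisymm (maxVal_le fun u => by simpa using le_maxVal h u) ?_
    have : maxVal h ≤ maxVal (h + fun _ => c) - c := maxVal_le fun u => by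
      have := le_maxVal (h + fun _ => c) u
      simp only [Pi.add_apply] at this
      linarith
    linarith
  simp only [expMax, ← add_assoc, e]
  rw [integral_add (integrable_maxVal hX hI τ) (integrable_const _)]
  simp

/-- The one-sided directional derivative of `expMax` at `τ` along `d` is attained by a
tie-breaking rule. -/
theorem exists_tendsto_expMax_slope (hX : Measurable X)
    (hI : ∀ u, Integrable (fun ω => X ω u) μ) (τ d : V → ℝ) :
    ∃ t ∈ tieRules V, Tendsto (fun s : ℝ => (expMax μ X (τ + s • d) - expMax μ X τ) / s)
      (𝓝[>] 0) (𝓝 (d ⬝ᵥ meanShare μ X τ t)) := by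
  classical
  have hex : ∀ A : Finset V, ∃ k, A.Nonempty → k ∈ A ∧ ∀ u ∈ A, d u ≤ d k := by
    intro A
    by_cases hA : A.Nonempty
    · obtain ⟨k, hk, hkd⟩ := A.exists_max_image d hA
      exact ⟨k, fun _ => ⟨hk, hkd⟩⟩
    · exact ⟨Classical.arbitrary V, fun h => absurd h hA⟩
  choose k hk using hex
  have ht := pi_single_mem_tieRules fun A hA => (hk A hA).1
  refine ⟨_, ht, ?_⟩
  set t : Finset V → V → ℝ := fun A => Pi.single (k A) 1
  have hlim : d ⬝ᵥ meanShare μ X τ t = ∫ ω, d (k (argmaxSet (X ω + τ))) ∂μ := by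
    have hm : ∀ u, Integrable (fun ω => t (argmaxSet (X ω + τ)) u) μ :=
      (integral_mem_simplex (μ := μ) ((measurable_comp_argmaxSet t τ).comp hX)
        fun ω => mem_simplex_of_mem_tieRules ht _).1
    simp only [dotProduct, meanShare, ← integral_const_mul]
    rw [← integral_finsetSum _ fun u _ => (hm u).const_mul (d u)]
    refine integral_congr_ae (ae_of_all _ fun ω => ?_)
    simp [t, Pi.single_apply]
  have hslope : ∀ s : ℝ, (expMax μ X (τ + s • d) - expMax μ X τ) / s
      = ∫ ω, (maxVal (X ω + τ + s • d) - maxVal (X ω + τ)) / s ∂μ := by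
    intro s
    rw [integral_div, integral_sub _ (integrable_maxVal hX hI τ)]
    · simp only [expMax, add_assoc]
    · simpa only [add_assoc] using integrable_maxVal hX hI (τ + s • d)
  simp only [hlim, hslope]
  refine tendsto_integral_filter_of_dominated_convergence (fun _ => ‖d‖)
    (Eventually.of_forall fun s => ?_) ?_ (integrable_const _) (ae_of_all _ fun ω => ?_)
  · exact (((measurable_maxVal.comp ((hX.add_const τ).add_const _)).sub
      (measurable_maxVal.comp (hX.add_const τ))).div_const s).aestronglyMeasurable
  · filter_upwards [self_mem_nhdsWithin] with s hs
    refine ae_of_all _ fun ω => ?_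
    have hs : 0 < s := hs
    rw [norm_div, Real.norm_of_nonneg hs.le, div_le_iff₀ hs]
    refine (abs_maxVal_add_sub_le _ _).trans ?_
    rw [norm_smul, Real.norm_of_nonneg hs.le, mul_comm]
  · obtain ⟨hk1, hk2⟩ := hk _ (argmaxSet_nonempty (X ω + τ))
    refine tendsto_const_nhds.congr' ?_
    filter_upwards [eventually_maxVal_add_smul (X ω + τ) d hk1 hk2, self_mem_nhdsWithin]
      with s hs hs0
    have hs0 : s ≠ 0 := ne_of_gt hs0
    rw [hs]
    field_simp
    ring

end ExpectedMaximum

section Duality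

variable {V : Type*} [Fintype V]

theorem exists_dotProduct_lt_of_disjoint {S F : Set (V → ℝ)} (hS : Convex ℝ S)
    (hSc : IsCompact S) (hF : Convex ℝ F) (hFc : IsClosed F) (h : Disjoint S F) :
    ∃ (d : V → ℝ) (c : ℝ), (∀ s ∈ S, d ⬝ᵥ s < c) ∧ ∀ r ∈ F, c < d ⬝ᵥ r := by
  classical
  obtain ⟨f, u, v, hu, huv, hv⟩ := geometric_hahn_banach_compact_closed hS hSc hF hFc h
  have e : ∀ x : V → ℝ, (fun i => f fun j => if i = j then 1 else 0) ⬝ᵥ x = f x := by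
    intro x
    have := LinearMap.pi_apply_eq_sum_univ (f : (V → ℝ) →ₗ[ℝ] ℝ) x
    simp only [ContinuousLinearMap.coe_coe, smul_eq_mul] at this
    rw [this]
    exact Finset.sum_congr rfl fun i _ => mul_comm _ _
  exact ⟨_, u, fun s hs => by rw [e]; exact hu s hs,
    fun r hr => by rw [e]; exact huv.trans (hv r hr)⟩

theorem dotProduct_const_of_mem_simplex {r : V → ℝ} (hr : r ∈ simplex V) (c : ℝ) :
    (fun _ => c) ⬝ᵥ r = c := by
  simp [dotProduct, ← Finset.mul_sum, hr.2]

/-- The support function of `K` from below. -/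
noncomputable def minDot (K : Set (V → ℝ)) (τ : V → ℝ) : ℝ :=
  sInf ((fun r => τ ⬝ᵥ r) '' K)

variable {K : Set (V → ℝ)}

theorem continuous_minDot (hK : IsCompact K) : Continuous (minDot K) :=
  hK.continuous_sInf (f := fun τ r => τ ⬝ᵥ r)
    (continuous_fst.dotProduct continuous_snd)

theorem minDot_le (hK : IsCompact K) {r : V → ℝ} (hr : r ∈ K) (τ : V → ℝ) :
    minDot K τ ≤ τ ⬝ᵥ r :=
  csInf_le (hK.image (continuous_const.dotProduct continuous_id)).bddBelow ⟨r, hr, rfl⟩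

theorem exists_eq_minDot (hK : IsCompact K) (hne : K.Nonempty) (τ : V → ℝ) :
    ∃ r ∈ K, τ ⬝ᵥ r = minDot K τ := by
  obtain ⟨r, hr, h⟩ := (hK.image (f := fun r => τ ⬝ᵥ r)
    (continuous_const.dotProduct continuous_id)).sInf_mem (hne.image _)
  exact ⟨r, hr, h⟩

theorem minDot_add_const (hK : IsCompact K) (hne : K.Nonempty) (hKs : K ⊆ simplex V)
    (τ : V → ℝ) (c : ℝ) : minDot K (τ + fun _ => c) = minDot K τ + c := by
  have e : ∀ r ∈ K, (τ + fun _ => c) ⬝ᵥ r = τ ⬝ᵥ r + c := fun r hr => by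
    rw [add_dotProduct, dotProduct_const_of_mem_simplex (hKs hr)]
  obtain ⟨r, hr, h⟩ := exists_eq_minDot hK hne τ
  obtain ⟨r', hr', h'⟩ := exists_eq_minDot hK hne (τ + fun _ => c)
  have h1 := minDot_le hK hr (τ + fun _ => c)
  have h2 := minDot_le hK hr' τ
  rw [e _ hr] at h1
  rw [e _ hr'] at h'
  linarith

variable [Nonempty V] {Ω : Type*} [MeasurableSpace Ω] {μ : Measure Ω} [IsProbabilityMeasure μ]
  {X : Ω → V → ℝ}

/-- The dual problem attains its minimum. -/
theorem exists_dual_minimizer (hX : Measurable X) (hI : ∀ u, Integrable (fun ω => X ω u) μ)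
    (hK : IsCompact K) (hKs : K ⊆ simplex V) {p : V → ℝ} (hpK : p ∈ K) (hp : ∀ u, 0 < p u) :
    ∃ τ, ∀ σ, expMax μ X τ - minDot K τ ≤ expMax μ X σ - minDot K σ := by
  set D : (V → ℝ) → ℝ := fun τ => expMax μ X τ - minDot K τ with hD
  have hDc : Continuous D := (continuous_expMax hX hI).sub (continuous_minDot hK)
  set C : ℝ := ∑ u, |∫ ω, X ω u ∂μ| with hC
  have hCle : ∀ u, -C ≤ ∫ ω, X ω u ∂μ := fun u => by
    have h1 := Finset.single_le_sum (f := fun v => |∫ ω, X ω v ∂μ|)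
      (fun v _ => abs_nonneg _) (Finset.mem_univ u)
    have h2 := neg_abs_le (∫ ω, X ω u ∂μ)
    exact (neg_le_neg h1).trans h2
  obtain ⟨w, hw⟩ := Finite.exists_min p
  set R : ℝ := max 0 ((D 0 + C) / p w) with hR
  have hR0 : 0 ≤ R := le_max_left _ _
  have hRw : D 0 + C ≤ R * p w := by
    rw [← div_le_iff₀ (hp w)]; exact le_max_right _ _
  set B : Set (V → ℝ) := Set.Icc (fun _ => -R) 0 with hB
  have h0B : (0 : V → ℝ) ∈ B := ⟨fun u => by simpa using hR0, le_rfl⟩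
  obtain ⟨τ, -, hmin⟩ := (isCompact_Icc : IsCompact B).exists_isMinOn ⟨0, h0B⟩ hDc.continuousOn
  refine ⟨τ, fun σ => ?_⟩
  -- Shift `σ` so that its maximum is zero.
  set σ' : V → ℝ := σ + fun _ => -maxVal σ with hσ'
  have hshift : D σ' = D σ := by
    simp only [hD, hσ', expMax_add_const hX hI, minDot_add_const hK ⟨p, hpK⟩ hKs]
    ring
  have hle : ∀ u, σ' u ≤ 0 := fun u => by
    have := le_maxVal σ u
    simp only [hσ', Pi.add_apply]; linarith
  obtain ⟨m, hm⟩ := exists_eq_maxVal σ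
  have hm0 : σ' m = 0 := by simp [hσ', hm]
  suffices D τ ≤ D σ' by rw [hshift] at this; exact this
  by_cases hσB : σ' ∈ B
  · exact hmin hσB
  · obtain ⟨u, hu⟩ : ∃ u, σ' u < -R := by
      by_contra! hcon
      exact hσB ⟨hcon, hle⟩
    have h1 := integral_add_le_expMax hX hI σ' m
    have h2 := minDot_le hK hpK σ'
    have h3 : σ' ⬝ᵥ p ≤ -R * p w := by
      have h4 : σ' ⬝ᵥ p ≤ σ' u * p u := by
        have h5 := Finset.single_le_sum (f := fun v => -(σ' v * p v))
          (fun v _ => neg_nonneg.2 (mul_nonpos_of_nonpos_of_nonneg (hle v) (hp v).le))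
          (Finset.mem_univ u)
        simp only [Finset.sum_neg_distrib] at h5
        simp only [dotProduct]
        linarith
      have h6 : σ' u * p u ≤ -R * p u := mul_le_mul_of_nonneg_right hu.le (hp u).le
      have h7 : R * p w ≤ R * p u := mul_le_mul_of_nonneg_left (hw u) hR0
      linarith
    have h8 : D τ ≤ D 0 := hmin h0B
    have h9 := hCle m
    have h10 : D σ' = expMax μ X σ' - minDot K σ' := rfl
    rw [hm0] at h1
    linarith

/-- At a dual minimizer some tie-breaking rule realizes a minimizer of `τ` over `K`. -/
theorem exists_saddle (hX : Measurable X) (hI : ∀ u, Integrable (fun ω => X ω u) μ)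
    (hK : IsCompact K) (hKc : Convex ℝ K) (hKs : K ⊆ simplex V) {p : V → ℝ} (hpK : p ∈ K)
    (hp : ∀ u, 0 < p u) :
    ∃ τ, ∃ t ∈ tieRules V, meanShare μ X τ t ∈ K ∧ ∀ r ∈ K, τ ⬝ᵥ meanShare μ X τ t ≤ τ ⬝ᵥ r := by
  obtain ⟨τ, hτ⟩ := exists_dual_minimizer hX hI hK hKs hpK hp
  refine ⟨τ, ?_⟩
  set S := meanShare μ X τ '' tieRules V
  set F := K ∩ {r | τ ⬝ᵥ r ≤ minDot K τ}
  have hFconv : Convex ℝ F := hKc.inter fun x hx y hy a b ha hb hab => by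
    simp only [Set.mem_ofPred_eq, dotProduct_add, dotProduct_smul, smul_eq_mul] at hx hy ⊢
    calc _ ≤ a * minDot K τ + b * minDot K τ := add_le_add
          (mul_le_mul_of_nonneg_left hx ha) (mul_le_mul_of_nonneg_left hy hb)
      _ = _ := by rw [← add_mul, hab, one_mul]
  have hFclosed : IsClosed F := hK.isClosed.inter
    (isClosed_le (continuous_const.dotProduct continuous_id) continuous_const)
  by_cases hdisj : Disjoint S F
  swap
  · obtain ⟨_, ⟨t, ht, rfl⟩, hr, hr'⟩ := Set.not_disjoint_iff.1 hdisj
    exact ⟨t, ht, hr, fun r hrK => le_trans hr' (minDot_le hK hrK τ)⟩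
  exfalso
  obtain ⟨d, c, hdS, hdF⟩ := exists_dotProduct_lt_of_disjoint
    (convex_image_meanShare hX τ) (isCompact_image_meanShare hX τ) hFconv hFclosed hdisj
  obtain ⟨t, ht, hlim⟩ := exists_tendsto_expMax_slope hX hI τ d
  have hseq : Tendsto (fun n : ℕ => 1 / ((n : ℝ) + 1)) atTop (𝓝[>] 0) :=
    tendsto_nhdsWithin_iff.2 ⟨tendsto_one_div_add_atTop_nhds_zero_nat,
      Eventually.of_forall fun n => by simp only [Set.mem_Ioi]; positivity⟩
  choose r hrK hr using fun n : ℕ =>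
    exists_eq_minDot hK ⟨p, hpK⟩ (τ + (1 / ((n : ℝ) + 1)) • d)
  obtain ⟨r₀, hr₀, φ, hφ, hconv⟩ := hK.tendsto_subseq hrK
  have hs := hseq.comp hφ.tendsto_atTop
  have hs0 : Tendsto (fun n => 1 / ((φ n : ℝ) + 1)) atTop (𝓝 0) :=
    hs.mono_right nhdsWithin_le_nhds
  have hr₀F : r₀ ∈ F := by
    refine ⟨hr₀, show τ ⬝ᵥ r₀ ≤ minDot K τ from le_of_eq ?_⟩
    have hτn : Tendsto (fun n => τ + (1 / ((φ n : ℝ) + 1)) • d) atTop (𝓝 τ) := by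
      simpa using (tendsto_const_nhds (x := τ)).add (hs0.smul_const d)
    have h1 := ((continuous_fst.dotProduct continuous_snd).tendsto (τ, r₀)).comp
      (hτn.prodMk_nhds hconv)
    have h2 := ((continuous_minDot hK).tendsto τ).comp hτn
    refine tendsto_nhds_unique h1 (h2.congr fun n => ?_)
    exact (hr (φ n)).symm
  have hle : d ⬝ᵥ r₀ ≤ d ⬝ᵥ meanShare μ X τ t := by
    have h1 := ((continuous_const (y := d)).dotProduct continuous_id).tendsto r₀ |>.comp hconv
    refine le_of_tendsto_of_tendsto' h1 (hlim.comp hs) fun n => ?_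
    have hpos : 0 < 1 / ((φ n : ℝ) + 1) := by positivity
    simp only [Function.comp_apply, id_eq]
    rw [le_div_iff₀ hpos]
    have h3 := hτ (τ + (1 / ((φ n : ℝ) + 1)) • d)
    have h4 := minDot_le hK (hrK (φ n)) τ
    rw [← hr (φ n), add_dotProduct, smul_dotProduct, smul_eq_mul] at h3
    rw [mul_comm]
    linarith
  have := hdS _ ⟨t, ht, rfl⟩
  have := hdF _ hr₀F
  linarith

end Duality

section Optimality

variable {V : Type*} [Fintype V]

/-- If a minimizer of `τ` over a divergence ball is interior, it is supported on the minimizers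
of the coordinates of `τ`. -/
theorem exists_min_of_KL_lt [Nonempty V] {p τ s : V → ℝ} {ε : ℝ} (hppos : ∀ u, 0 < p u)
    (hs : s ∈ simplex V) (hlt : KL s p < ε) (hmin : ∀ r ∈ klBall p ε, τ ⬝ᵥ s ≤ τ ⬝ᵥ r) :
    ∃ w, (∀ u, τ w ≤ τ u) ∧ ∀ u, τ u ≠ τ w → s u = 0 := by
  classical
  obtain ⟨w, hw⟩ := Finite.exists_min τ
  refine ⟨w, hw, ?_⟩
  have hcont : Continuous fun a : ℝ => KL ((1 - a) • s + a • Pi.single w (1 : ℝ)) p :=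
    (continuous_KL hppos).comp (by fun_prop)
  have h0 : Tendsto (fun a : ℝ => KL ((1 - a) • s + a • Pi.single w (1 : ℝ)) p) (𝓝[>] 0)
      (𝓝 (KL s p)) := by
    simpa using (hcont.tendsto 0).mono_left nhdsWithin_le_nhds
  obtain ⟨a, hKL, ha0, ha1⟩ := ((h0.eventually_lt_const hlt).and
    (Ioo_mem_nhdsGT (zero_lt_one (α := ℝ)))).exists
  have h1 := hmin _ ⟨convex_stdSimplex ℝ V hs (single_mem_stdSimplex ℝ w)
    (sub_nonneg.2 ha1.le) ha0.le (by ring), hKL.le⟩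
  simp only [dotProduct_add, dotProduct_smul, smul_eq_mul, dotProduct_single, mul_one] at h1
  have h2 : τ ⬝ᵥ s ≤ τ w := by
    by_contra! h
    have := mul_pos ha0 (sub_pos.2 h)
    linarith
  have h3 : ∑ u, (τ u - τ w) * s u ≤ 0 := by
    have e : ∑ u, (τ u - τ w) * s u = τ ⬝ᵥ s - τ w := by
      simp [sub_mul, dotProduct, ← Finset.mul_sum, hs.2]
    rw [e]; linarith
  have hnn : ∀ u ∈ Finset.univ, 0 ≤ (τ u - τ w) * s u := fun u _ =>
    mul_nonneg (sub_nonneg.2 (hw u)) (hs.1 u)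
  intro u hu
  have h4 := (Finset.sum_eq_zero_iff_of_nonneg hnn).1
    (le_antisymm h3 (Finset.sum_nonneg hnn)) u (Finset.mem_univ u)
  exact (mul_eq_zero.1 h4).resolve_left (sub_ne_zero.2 hu)

variable {Ω : Type*} [MeasurableSpace Ω] {μ : Measure Ω} {X : Ω → V → ℝ}

theorem integrable_mul_of_simplex (hI : ∀ u, Integrable (fun ω => X ω u) μ) {q : Ω → V → ℝ}
    (hq : Measurable q) (hqs : ∀ ω, q ω ∈ simplex V) (u : V) :
    Integrable (fun ω => X ω u * q ω u) μ :=
  (hI u).mul_bdd (c := 1) ((measurable_pi_apply u).comp hq).aestronglyMeasurable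
    (ae_of_all _ fun ω => by
      rw [Real.norm_of_nonneg ((hqs ω).1 u)]; exact le_one_of_mem_simplex (hqs ω) u)

theorem integral_sum_add_dotProduct [IsProbabilityMeasure μ]
    (hI : ∀ u, Integrable (fun ω => X ω u) μ)
    {q : Ω → V → ℝ} (hq : Measurable q) (hqs : ∀ ω, q ω ∈ simplex V) (τ : V → ℝ) :
    ∫ ω, ∑ u, X ω u * q ω u ∂μ + τ ⬝ᵥ (fun u => ∫ ω, q ω u ∂μ)
      = ∫ ω, (X ω + τ) ⬝ᵥ q ω ∂μ := by
  have hi := (integral_mem_simplex (μ := μ) hq hqs).1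
  simp only [dotProduct, ← integral_const_mul]
  rw [← integral_finsetSum _ fun u _ => (hi u).const_mul (τ u), ← integral_add
    (integrable_finsetSum _ fun u _ => integrable_mul_of_simplex hI hq hqs u)
    (integrable_finsetSum _ fun u _ => (hi u).const_mul (τ u))]
  simp only [Pi.add_apply, add_mul, Finset.sum_add_distrib]

theorem dotProduct_le_maxVal [Nonempty V] {q : V → ℝ} (hq : q ∈ simplex V) (h : V → ℝ) :
    h ⬝ᵥ q ≤ maxVal h := by
  rw [← dotProduct_const_of_mem_simplex hq (maxVal h)]
  exact Finset.sum_le_sum fun u _ => mul_le_mul_of_nonneg_right (le_maxVal h u) (hq.1 u)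

theorem dotProduct_tieRule [Nonempty V] {t : Finset V → V → ℝ} (ht : t ∈ tieRules V)
    (h : V → ℝ) : h ⬝ᵥ t (argmaxSet h) = maxVal h := by
  have hq := mem_simplex_of_mem_tieRules ht (argmaxSet h)
  rw [← dotProduct_const_of_mem_simplex hq (maxVal h)]
  refine Finset.sum_congr rfl fun u _ => ?_
  by_cases hu : u ∈ argmaxSet h
  · rw [mem_argmaxSet_iff.1 hu]
  · rw [(ht _ trivial).2 u (argmaxSet_nonempty h) hu, mul_zero, mul_zero]

/-- A tie-breaking rule whose mean minimizes `τ` over `K` is optimal among the rules with mean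
in `K`. -/
theorem integral_le_of_saddle [Nonempty V] [IsProbabilityMeasure μ] {K : Set (V → ℝ)}
    (hX : Measurable X)
    (hI : ∀ u, Integrable (fun ω => X ω u) μ) {τ : V → ℝ} {t : Finset V → V → ℝ}
    (ht : t ∈ tieRules V) (hmin : ∀ r ∈ K, τ ⬝ᵥ meanShare μ X τ t ≤ τ ⬝ᵥ r)
    {q : Ω → V → ℝ} (hq : Measurable q) (hqs : ∀ ω, q ω ∈ simplex V)
    (hqK : (fun u => ∫ ω, q ω u ∂μ) ∈ K) :
    ∫ ω, ∑ u, X ω u * q ω u ∂μ ≤ ∫ ω, ∑ u, X ω u * t (argmaxSet (X ω + τ)) u ∂μ := by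
  have h1 := integral_sum_add_dotProduct hI hq hqs τ
  have h2 := integral_sum_add_dotProduct (μ := μ) hI
    ((measurable_comp_argmaxSet t τ).comp hX) (fun ω => mem_simplex_of_mem_tieRules ht _) τ
  simp only [Function.comp_apply, dotProduct_tieRule ht] at h2
  have h3 : ∫ ω, (X ω + τ) ⬝ᵥ q ω ∂μ ≤ ∫ ω, maxVal (X ω + τ) ∂μ := by
    refine integral_mono ?_ (integrable_maxVal hX hI τ) fun ω => dotProduct_le_maxVal (hqs ω) _
    exact integrable_finsetSum _ fun u _ => integrable_mul_of_simplex
      (X := fun ω => X ω + τ) (fun u => (hI u).add (integrable_const _)) hq hqs u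
  have h4 := hmin _ hqK
  change τ ⬝ᵥ (fun u => ∫ ω, t (argmaxSet (X ω + τ)) u ∂μ) ≤ _ at h4
  linarith

end Optimality

theorem stmt_10 {V : Type*} [Fintype V] [Nonempty V]
    {Ω : Type*} [MeasurableSpace Ω] (μ : Measure Ω) [IsProbabilityMeasure μ]
    (G : Ω → V → ℝ) (hG : Measurable G)
    (ν : Measure ℝ) [IsProbabilityMeasure ν]
    -- `ν` has a finite first moment
    (hmom : Integrable (fun x : ℝ => x) ν)
    -- the coordinates of `G` are i.i.d. with law `ν`
    (hlaw : Measure.map G μ = Measure.pi (fun _ : V => ν))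
    (p : V → ℝ) (hp : p ∈ simplex V) (hppos : ∀ u, 0 < p u)
    (ε : ℝ) (hε : 0 ≤ ε) :
    ∃ (τ : V → ℝ) (T : (V → ℝ) → V → ℝ),
      -- `T` is a tie-breaking rule supported on `argmax_v (g_v + τ_v)`
      (∀ g u, 0 ≤ T g u ∧ T g u ≤ 1) ∧
      (∀ g u, ¬ (∀ v, g v + τ v ≤ g u + τ u) → T g u = 0) ∧
      (∀ g : V → ℝ, ∑ u, T g u = 1) ∧
      -- the resulting sampling rule `q*(g)_u = T_u(g)` is feasible
      Measurable T ∧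
      KL (fun u => ∫ ω, T (G ω) u ∂μ) p ≤ ε ∧
      -- and optimal among all feasible sampling rules
      (∀ q : (V → ℝ) → V → ℝ, Measurable q → (∀ g, q g ∈ simplex V) →
        KL (fun u => ∫ ω, q (G ω) u ∂μ) p ≤ ε →
        ∫ ω, ∑ u, G ω u * q (G ω) u ∂μ ≤ ∫ ω, ∑ u, G ω u * T (G ω) u ∂μ) ∧
      -- the KL constraint is saturated, unless `τ = 0` already yields a
      -- feasible solution
      (KL (fun u => ∫ ω, T (G ω) u ∂μ) p = ε ∨ τ = 0) := by
  classical
  have hI : ∀ u, Integrable (fun ω => G ω u) μ := fun u => by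
    have h : Integrable (fun g : V → ℝ => g u) (Measure.map G μ) := by
      rw [hlaw]; exact integrable_comp_eval (μ := fun _ : V => ν) (f := fun x : ℝ => x) hmom
    exact h.comp_measurable hG
  obtain ⟨τ, t, ht, hmem, hmin⟩ := exists_saddle hG hI (isCompact_klBall hppos ε)
    (convex_klBall hppos ε) (fun _ h => h.1) (p := p)
    ⟨hp, (KL_self hppos).le.trans hε⟩ hppos
  have hopt : ∀ q : (V → ℝ) → V → ℝ, Measurable q → (∀ g, q g ∈ simplex V) →
      KL (fun u => ∫ ω, q (G ω) u ∂μ) p ≤ ε →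
      ∫ ω, ∑ u, G ω u * q (G ω) u ∂μ
        ≤ ∫ ω, ∑ u, G ω u * t (argmaxSet (G ω + τ)) u ∂μ := fun q hq hqs hqε =>
    integral_le_of_saddle hG hI ht hmin (hq.comp hG) (fun ω => hqs _)
      ⟨(integral_mem_simplex (hq.comp hG) fun ω => hqs _).2, hqε⟩
  have hsimp := mem_simplex_of_mem_tieRules ht
  have hsupp : ∀ (σ g : V → ℝ) u, ¬ (∀ v, g v + σ v ≤ g u + σ u) →
      t (argmaxSet (g + σ)) u = 0 := fun σ g u hu =>
    (ht _ trivial).2 u (argmaxSet_nonempty _) fun h => hu (mem_argmaxSet.1 h)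
  rcases hmem.2.eq_or_lt with heq | hlt
  · exact ⟨τ, fun g => t (argmaxSet (g + τ)),
      fun g u => ⟨(hsimp _).1 u, le_one_of_mem_simplex (hsimp _) u⟩, hsupp τ,
      fun g => (hsimp _).2, measurable_comp_argmaxSet t τ, hmem.2, hopt, Or.inl heq⟩
  -- The constraint is slack: almost surely the rule already selects maximizers of `G`.
  obtain ⟨w, hw, hzero⟩ := exists_min_of_KL_lt hppos hmem.1 hlt hmin
  set T : (V → ℝ) → V → ℝ := fun g =>
    if ∀ u, τ u ≠ τ w → t (argmaxSet (g + τ)) u = 0 then t (argmaxSet (g + τ))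
    else t (argmaxSet (g + 0)) with hT
  have hTs : ∀ g, T g ∈ simplex V := fun g => by
    simp only [hT]; split_ifs <;> exact hsimp _
  have hae : ∀ᵐ ω ∂μ, T (G ω) = t (argmaxSet (G ω + τ)) := by
    have h : ∀ᵐ ω ∂μ, ∀ u, τ u ≠ τ w → t (argmaxSet (G ω + τ)) u = 0 := by
      refine ae_all_iff.2 fun u => ?_
      by_cases hu : τ u = τ w
      · simp [hu]
      · have hint := (integral_mem_simplex (μ := μ)
          ((measurable_comp_argmaxSet t τ).comp hG) fun ω => hsimp _).1 u
        filter_upwards [(integral_eq_zero_iff_of_nonneg (fun ω => (hsimp _).1 u) hint).1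
          (hzero u hu)] with ω hω _ using hω
    filter_upwards [h] with ω hω
    simp only [hT, if_pos hω]
  have hmean : (fun u => ∫ ω, T (G ω) u ∂μ) = meanShare μ G τ t := by
    ext u
    exact integral_congr_ae (hae.mono fun ω h => by simp only [h])
  have hval : ∫ ω, ∑ u, G ω u * T (G ω) u ∂μ
      = ∫ ω, ∑ u, G ω u * t (argmaxSet (G ω + τ)) u ∂μ :=
    integral_congr_ae (hae.mono fun ω h => by simp only [h])
  refine ⟨0, T, fun g u => ⟨(hTs g).1 u, le_one_of_mem_simplex (hTs g) u⟩, fun g u hu => ?_,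
    fun g => (hTs g).2, ?_, ?_, ?_, Or.inr rfl⟩
  · simp only [hT]
    split_ifs with hc
    · by_cases hτu : τ u = τ w
      · refine hsupp τ g u fun H => hu fun v => ?_
        have h1 := H v
        have h2 := hw v
        simp only [Pi.zero_apply, add_zero]
        linarith
      · exact hc u hτu
    · exact hsupp 0 g u hu
  · refine Measurable.ite ?_ (measurable_comp_argmaxSet t τ) (measurable_comp_argmaxSet t 0)
    have h := measurable_comp_argmaxSet (fun A => ∀ u, τ u ≠ τ w → t A u = 0) τ
    exact measurableSet_setOfPred.2 h
  · rw [hmean]; exact hmem.2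
  · rw [hval]; exact hopt
end

section
/- Let Σ be a nonempty finite set, let p ∈ Δ(Σ) have full support, let G = (G_u)_{u∈Σ} be a random vector whose coordinates are i.i.d. with the standard Gumbel distribution, and let δ > 0. Then the function q*(g)_u = 1{u = argmax_{v∈Σ}(g_v + (1/(1+δ)) log p_v)} maximizes the functional q ↦ E[Σ_{u∈Σ} G_u q(G)_u] − (1/δ)·KL(E[q(G)] ‖ p) over measurable functions q : ℝ^Σ → Δ(Σ). -/
open Finset MeasureTheory

/-- A choice of maximizer of `f : V → ℝ`. -/
noncomputable def argmaxOf {V : Type*} [Fintype V] [Nonempty V] (f : V → ℝ) : V :=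
  (Finset.exists_max_image Finset.univ f Finset.univ_nonempty).choose

open Classical in
/-- The deterministic sampling rule `q*(g)_u = 1{u = argmax_v (g_v + α log p_v)}`. -/
noncomputable def qArgmax {V : Type*} [Fintype V] [Nonempty V] (p : V → ℝ) (α : ℝ) :
    (V → ℝ) → V → ℝ :=
  fun g u => if u = argmaxOf (fun v => g v + α * Real.log (p v)) then 1 else 0

lemma argmaxOf_spec {V : Type*} [Fintype V] [Nonempty V] (f : V → ℝ) (v : V) :
    f v ≤ f (argmaxOf f) :=
  (Finset.exists_max_image Finset.univ f Finset.univ_nonempty).choose_spec.2 v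
    (Finset.mem_univ v)

/-- The selected maximizer depends on `f` only through its set of maximizers. -/
lemma argmaxOf_congr {V : Type*} [Fintype V] [Nonempty V] {f g : V → ℝ}
    (h : {u | ∀ v, f v ≤ f u} = {u | ∀ v, g v ≤ g u}) : argmaxOf f = argmaxOf g := by
  have h' : (fun u => u ∈ Finset.univ ∧ ∀ v ∈ Finset.univ, f v ≤ f u) =
      fun u => u ∈ Finset.univ ∧ ∀ v ∈ Finset.univ, g v ≤ g u := by
    funext u
    have := Set.ext_iff.1 h u
    simpa using this
  unfold argmaxOf
  congr 1

lemma measurableSet_argmaxOf_eq {V : Type*} [Fintype V] [Nonempty V] (a : V → ℝ) (u : V) :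
    MeasurableSet {g : V → ℝ | argmaxOf (fun v => g v + a v) = u} := by
  let S : (V → ℝ) → Set V := fun g => {w | ∀ v, g v + a v ≤ g w + a w}
  have hS : ∀ T : Set V, MeasurableSet {g | S g = T} := by
    intro T
    have : {g | S g = T} =
        ⋂ w, {g : V → ℝ | (∀ v, g v + a v ≤ g w + a w) ↔ w ∈ T} := by
      ext g
      simp [S, Set.ext_iff]
    rw [this]
    refine MeasurableSet.iInter fun w => ?_
    have hw : MeasurableSet {g : V → ℝ | ∀ v, g v + a v ≤ g w + a w} := by
      simp only [Set.ofPred_forall]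
      exact MeasurableSet.iInter fun v => measurableSet_le (by fun_prop) (by fun_prop)
    by_cases hT : w ∈ T
    · simpa [hT] using hw
    · simp only [hT, iff_false]
      exact hw.compl
  have : {g : V → ℝ | argmaxOf (fun v => g v + a v) = u} =
      ⋃ T ∈ {T : Set V | ∃ g, S g = T ∧ argmaxOf (fun v => g v + a v) = u}, {g | S g = T} := by
    ext g
    simp only [Set.mem_ofPred_eq, Set.mem_iUnion, exists_prop]
    constructor
    · intro h
      exact ⟨_, ⟨g, rfl, h⟩, rfl⟩
    · rintro ⟨T, ⟨g', h1, h2⟩, h3⟩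
      rw [← h2]
      exact argmaxOf_congr (h3.trans h1.symm)
  rw [this]
  exact MeasurableSet.biUnion (Set.to_countable _) fun T _ => hS T

lemma measurable_qArgmax {V : Type*} [Fintype V] [Nonempty V] (p : V → ℝ) (α : ℝ) :
    Measurable (qArgmax p α) := by
  classical
  refine measurable_pi_lambda _ fun u => ?_
  unfold qArgmax
  refine Measurable.ite ?_ measurable_const measurable_const
  simpa only [eq_comm] using measurableSet_argmaxOf_eq (fun v => α * Real.log (p v)) u

lemma qArgmax_mem_simplex {V : Type*} [Fintype V] [Nonempty V] (p : V → ℝ) (α : ℝ)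
    (g : V → ℝ) : qArgmax p α g ∈ simplex V := by
  refine ⟨fun u => ?_, ?_⟩
  · unfold qArgmax
    split_ifs <;> norm_num
  · rw [Finset.sum_eq_single (argmaxOf fun v => g v + α * Real.log (p v))]
    · simp [qArgmax]
    · intro u _ hu
      simp [qArgmax, hu]
    · simp

/-- `qArgmax` maximizes the perturbed linear functional pointwise over the simplex. -/
lemma sum_mul_le_sum_mul_qArgmax {V : Type*} [Fintype V] [Nonempty V] (p : V → ℝ) (α : ℝ)
    (g : V → ℝ) {q : V → ℝ} (hq : q ∈ simplex V) :
    ∑ u, (g u + α * Real.log (p u)) * q u ≤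
      ∑ u, (g u + α * Real.log (p u)) * qArgmax p α g u := by
  have h := argmaxOf_spec (fun v => g v + α * Real.log (p v))
  calc ∑ u, (g u + α * Real.log (p u)) * q u
      ≤ ∑ u, (g (argmaxOf fun v => g v + α * Real.log (p v)) +
          α * Real.log (p (argmaxOf fun v => g v + α * Real.log (p v)))) * q u :=
        Finset.sum_le_sum fun u _ => mul_le_mul_of_nonneg_right (h u) (hq.1 u)
    _ = _ := by
        rw [← Finset.mul_sum, hq.2,
          Finset.sum_eq_single (argmaxOf fun v => g v + α * Real.log (p v))]
        · simp [qArgmax]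
        · intro u _ hu
          simp [qArgmax, hu]
        · simp

/-- Entropic optimality of the softmax distribution. -/
lemma sum_mul_add_KL_ge {V : Type*} [Fintype V] [Nonempty V] {p : V → ℝ}
    (hppos : ∀ u, 0 < p u) {δ : ℝ} (hδ : 0 < δ) {a m r : V → ℝ}
    (ha : ∀ u, a u = 1 / (1 + δ) * Real.log (p u))
    (hm : ∀ u, m u = Real.exp (a u) / ∑ v, Real.exp (a v)) (hr : r ∈ simplex V) :
    ∑ u, a u * m u + (1 / δ) * KL m p ≤ ∑ u, a u * r u + (1 / δ) * KL r p := by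
  set Z := ∑ v, Real.exp (a v)
  have hZ : 0 < Z := Finset.sum_pos (fun v _ => Real.exp_pos _) Finset.univ_nonempty
  have hmpos : ∀ u, 0 < m u := fun u => by rw [hm]; positivity
  have hmsum : ∑ u, m u = 1 := by
    simp only [hm]
    rw [← Finset.sum_div]
    exact div_self hZ.ne'
  have hlogm : ∀ u, Real.log (m u) = a u - Real.log Z := fun u => by
    rw [hm, Real.log_div (Real.exp_pos _).ne' hZ.ne', Real.log_exp]
  have hlogp : ∀ u, Real.log (p u) = (1 + δ) * a u := fun u => by
    rw [ha]; field_simp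
  have key : ∀ s : V → ℝ, (∀ u, 0 ≤ s u) → ∑ u, s u = 1 →
      ∑ u, a u * s u + (1 / δ) * KL s p =
        (1 / δ) * (∑ u, s u * (Real.log (s u) - Real.log (m u)) - Real.log Z) := by
    intro s hs hs1
    have : Real.log Z = ∑ u, s u * Real.log Z := by rw [← Finset.sum_mul, hs1, one_mul]
    rw [this, KL, ← Finset.sum_sub_distrib, Finset.mul_sum, Finset.mul_sum,
      ← Finset.sum_add_distrib]
    refine Finset.sum_congr rfl fun u _ => ?_
    rcases (hs u).eq_or_lt with h | h
    · simp [← h]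
    · rw [Real.log_div h.ne' (hppos u).ne', hlogp, hlogm]
      field_simp
      ring
  rw [key m (fun u => (hmpos u).le) hmsum, key r hr.1 hr.2]
  have hnonneg : 0 ≤ ∑ u, r u * (Real.log (r u) - Real.log (m u)) := by
    calc (0 : ℝ) = ∑ u, (r u - m u) := by rw [Finset.sum_sub_distrib, hr.2, hmsum, sub_self]
      _ ≤ _ := by
        refine Finset.sum_le_sum fun u _ => ?_
        rcases (hr.1 u).eq_or_lt with h | h
        · simp [← h, (hmpos u).le]
        · have h1 := Real.log_le_sub_one_of_pos (div_pos (hmpos u) h)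
          rw [Real.log_div (hmpos u).ne' h.ne'] at h1
          have h2 := mul_le_mul_of_nonneg_left h1 h.le
          have h3 : r u * (m u / r u - 1) = m u - r u := by field_simp
          linarith
  refine mul_le_mul_of_nonneg_left (sub_le_sub_right ?_ _) (by positivity)
  simpa using hnonneg

lemma gumbel_measure_Ioi {ν : Measure ℝ} [IsProbabilityMeasure ν]
    (hcdf : ∀ x : ℝ, ν (Set.Iic x) = ENNReal.ofReal (Real.exp (-Real.exp (-x)))) (x : ℝ) :
    ν (Set.Ioi x) = ENNReal.ofReal (1 - Real.exp (-Real.exp (-x))) := by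
  rw [← Set.compl_Iic, prob_compl_eq_one_sub measurableSet_Iic, hcdf,
    ENNReal.ofReal_sub _ (Real.exp_pos _).le, ENNReal.ofReal_one]

lemma integrable_id_gumbel {ν : Measure ℝ} [IsProbabilityMeasure ν]
    (hcdf : ∀ x : ℝ, ν (Set.Iic x) = ENNReal.ofReal (Real.exp (-Real.exp (-x)))) :
    Integrable (fun x : ℝ => x) ν := by
  refine ⟨measurable_id.aestronglyMeasurable, ?_⟩
  rw [hasFiniteIntegral_iff_norm]
  simp only [Real.norm_eq_abs]
  rw [lintegral_eq_lintegral_meas_lt ν (Filter.Eventually.of_forall fun x => abs_nonneg x)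
    (by fun_prop)]
  have hbound : ∀ t : ℝ, ν {x | t < |x|} ≤ ENNReal.ofReal (2 * Real.exp (-t)) := by
    intro t
    have hsub : {x : ℝ | t < |x|} ⊆ Set.Ioi t ∪ Set.Iic (-t) := by
      intro x hx
      rcases lt_abs.1 (show t < |x| from hx) with h | h
      · exact Or.inl h
      · exact Or.inr (by simp only [Set.mem_Iic]; linarith)
    refine (measure_mono hsub).trans ((measure_union_le _ _).trans ?_)
    rw [gumbel_measure_Ioi hcdf, hcdf, two_mul,
      ENNReal.ofReal_add (Real.exp_pos _).le (Real.exp_pos _).le, neg_neg]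
    refine add_le_add (ENNReal.ofReal_le_ofReal ?_) (ENNReal.ofReal_le_ofReal ?_)
    · have := Real.add_one_le_exp (-Real.exp (-t))
      linarith
    · have := Real.add_one_le_exp t
      exact Real.exp_le_exp.2 (by linarith)
  refine (lintegral_mono fun t => hbound t).trans_lt ?_
  exact ((integrableOn_exp_neg_Ioi 0).const_mul 2).lintegral_lt_top

/-- The Laplace transform of `exp (-X)` for a standard Gumbel variable `X`. -/
lemma lintegral_exp_neg_mul_exp_neg_gumbel {ν : Measure ℝ} [IsProbabilityMeasure ν]
    (hcdf : ∀ x : ℝ, ν (Set.Iic x) = ENNReal.ofReal (Real.exp (-Real.exp (-x))))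
    {c : ℝ} (hc : 0 ≤ c) :
    ∫⁻ x, ENNReal.ofReal (Real.exp (-(c * Real.exp (-x)))) ∂ν = ENNReal.ofReal (1 / (1 + c)) := by
  rcases hc.eq_or_lt with rfl | hc
  · simp
  rw [lintegral_eq_lintegral_meas_lt ν (Filter.Eventually.of_forall fun x => (Real.exp_pos _).le)
    (by fun_prop)]
  have hset : ∀ t ∈ Set.Ioi (0 : ℝ), ν {x | t < Real.exp (-(c * Real.exp (-x)))} =
      (Set.Ioo (0 : ℝ) 1).indicator (fun t => ENNReal.ofReal (1 - t ^ (1 / c))) t := by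
    intro t ht
    have ht : 0 < t := ht
    by_cases h1 : t < 1
    · have hl : 0 < -Real.log t / c := div_pos (neg_pos.2 (Real.log_neg ht h1)) hc
      have : {x | t < Real.exp (-(c * Real.exp (-x)))} =
          Set.Ioi (-Real.log (-Real.log t / c)) := by
        ext x
        rw [Set.mem_ofPred_eq, Set.mem_Ioi, ← Real.log_lt_iff_lt_exp ht, neg_lt,
          Real.lt_log_iff_exp_lt hl, lt_div_iff₀ hc]
        constructor <;> intro h <;> linarith
      rw [this, gumbel_measure_Ioi hcdf, neg_neg, Real.exp_log hl,
        Set.indicator_of_mem (Set.mem_Ioo.2 ⟨ht, h1⟩), Real.rpow_def_of_pos ht]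
      congr 3
      ring
    · rw [Set.indicator_of_notMem (fun h => h1 h.2)]
      convert measure_empty (μ := ν)
      ext x
      simp only [Set.mem_ofPred_eq, Set.mem_empty_iff_false, iff_false, not_lt]
      refine le_trans ?_ (not_lt.1 h1)
      rw [Real.exp_le_one_iff]
      have : 0 < c * Real.exp (-x) := by positivity
      linarith
  rw [setLIntegral_congr_fun measurableSet_Ioi hset, setLIntegral_indicator measurableSet_Ioo,
    Set.inter_eq_left.2 Set.Ioo_subset_Ioi_self]
  have hc' : (0 : ℝ) ≤ 1 / c := by positivity
  have hint : IntervalIntegrable (fun t : ℝ => 1 - t ^ (1 / c)) volume 0 1 :=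
    (continuous_const.sub (Real.continuous_rpow_const hc')).intervalIntegrable _ _
  have hintOn : IntegrableOn (fun t : ℝ => 1 - t ^ (1 / c)) (Set.Ioo 0 1) :=
    (intervalIntegrable_iff_integrableOn_Ioo_of_le zero_le_one).1 hint
  rw [← ofReal_integral_eq_lintegral_ofReal hintOn]
  · congr 1
    rw [← integral_Ioc_eq_integral_Ioo, ← intervalIntegral.integral_of_le zero_le_one,
      intervalIntegral.integral_sub (by simp)
        ((Real.continuous_rpow_const hc').intervalIntegrable _ _),
      integral_rpow (Or.inl (by linarith))]
    have : (1 / c + 1) ≠ 0 := by positivity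
    rw [Real.zero_rpow this]
    simp
    field_simp
    ring
  · refine (ae_restrict_iff' measurableSet_Ioo).2 (Filter.Eventually.of_forall fun t ht => ?_)
    have := Real.rpow_le_one ht.1.le ht.2.le hc'
    simpa using this

/-- The Gumbel-max trick. -/
lemma gumbel_max {V : Type*} [Fintype V] {ν : Measure ℝ} [IsProbabilityMeasure ν]
    (hcdf : ∀ x : ℝ, ν (Set.Iic x) = ENNReal.ofReal (Real.exp (-Real.exp (-x))))
    (a : V → ℝ) (u : V) :
    Measure.pi (fun _ : V => ν) {g | ∀ v, g v + a v ≤ g u + a u} =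
      ENNReal.ofReal (Real.exp (a u) / ∑ v, Real.exp (a v)) := by
  classical
  let c : ℝ := ∑ v : {v // ¬ v = u}, Real.exp (a v - a u)
  have hc : 0 ≤ c := Finset.sum_nonneg fun v _ => (Real.exp_pos _).le
  have hmp := measurePreserving_piEquivPiSubtypeProd (fun _ : V => ν) (fun v => v = u)
  let S : Set (({v // v = u} → ℝ) × ({v // ¬ v = u} → ℝ)) :=
    {z | ∀ v, z.2 v ≤ z.1 ⟨u, rfl⟩ + a u - a v}
  have hS : MeasurableSet S := by
    simp only [S, Set.ofPred_forall]
    exact MeasurableSet.iInter fun v => measurableSet_le (by fun_prop) (by fun_prop)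
  have hpre : {g : V → ℝ | ∀ v, g v + a v ≤ g u + a u} =
      MeasurableEquiv.piEquivPiSubtypeProd (fun _ : V => ℝ) (fun v => v = u) ⁻¹' S := by
    ext g
    simp only [Set.mem_ofPred_eq, Set.mem_preimage, S]
    constructor
    · intro h v
      have := h v
      change g v ≤ g u + a u - a v
      linarith
    · intro h v
      by_cases hv : v = u
      · rw [hv]
      · have : g v ≤ g u + a u - a v := h ⟨v, hv⟩
        linarith
  have hslice : ∀ y : {v // v = u} → ℝ,
      Measure.pi (fun _ : {v // ¬ v = u} => ν) (Prod.mk y ⁻¹' S) =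
        ENNReal.ofReal (Real.exp (-(c * Real.exp (-(y ⟨u, rfl⟩))))) := by
    intro y
    have : Prod.mk y ⁻¹' S =
        Set.univ.pi fun v : {v // ¬ v = u} => Set.Iic (y ⟨u, rfl⟩ + a u - a v) := by
      ext z
      simp [S, Pi.le_def]
    rw [this, Measure.pi_pi]
    simp only [hcdf]
    rw [← ENNReal.ofReal_prod_of_nonneg fun v _ => (Real.exp_pos _).le, ← Real.exp_sum,
      Finset.sum_neg_distrib, Finset.sum_mul]
    congr 3
    refine Finset.sum_congr rfl fun v _ => ?_
    rw [← Real.exp_add]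
    ring_nf
  rw [hpre, hmp.measure_preimage hS.nullMeasurableSet, Measure.prod_apply hS]
  simp only [hslice]
  have hev := measurePreserving_eval (fun _ : {v // v = u} => ν) ⟨u, rfl⟩
  have := hev.lintegral_comp
    (f := fun x => ENNReal.ofReal (Real.exp (-(c * Real.exp (-x))))) (by fun_prop)
  simp only [Function.eval] at this
  rw [lintegral_exp_neg_mul_exp_neg_gumbel hcdf hc] at this
  trans ENNReal.ofReal (1 / (1 + c))
  · convert this
  congr 1
  have hZ : ∑ v, Real.exp (a v) = Real.exp (a u) * (1 + c) := by
    rw [Fintype.sum_eq_add_sum_subtype_ne _ u, mul_add, mul_one, Finset.mul_sum]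
    congr 1
    refine Finset.sum_congr rfl fun v _ => ?_
    rw [← Real.exp_add]
    ring_nf
  rw [hZ]
  have : 0 < 1 + c := by linarith
  field_simp

lemma integrable_simplex_coord {V : Type*} [Fintype V] {Ω : Type*} [MeasurableSpace Ω]
    {μ : Measure Ω} [IsProbabilityMeasure μ] {G : Ω → V → ℝ} (hG : Measurable G)
    {q : (V → ℝ) → V → ℝ} (hq : Measurable q) (hqs : ∀ g, q g ∈ simplex V) (u : V) :
    Integrable (fun ω => q (G ω) u) μ := by
  refine Integrable.of_bound (C := 1)
    ((measurable_pi_iff.1 (hq.comp hG) u).aestronglyMeasurable)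
    (Filter.Eventually.of_forall fun ω => ?_)
  rw [Real.norm_eq_abs, abs_of_nonneg ((hqs _).1 u), ← (hqs (G ω)).2]
  exact Finset.single_le_sum (fun v _ => (hqs _).1 v) (Finset.mem_univ u)

lemma integral_simplex_mem {V : Type*} [Fintype V] {Ω : Type*} [MeasurableSpace Ω]
    {μ : Measure Ω} [IsProbabilityMeasure μ] {G : Ω → V → ℝ} (hG : Measurable G)
    {q : (V → ℝ) → V → ℝ} (hq : Measurable q) (hqs : ∀ g, q g ∈ simplex V) :
    (fun u => ∫ ω, q (G ω) u ∂μ) ∈ simplex V := by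
  refine ⟨fun u => integral_nonneg fun ω => (hqs _).1 u, ?_⟩
  rw [← integral_finsetSum _ fun u _ => integrable_simplex_coord hG hq hqs u]
  simp [(hqs _).2]

/-- The selection probabilities of `qArgmax` under Gumbel noise form a softmax. -/
lemma integral_qArgmax_gumbel {V : Type*} [Fintype V] [Nonempty V]
    {Ω : Type*} [MeasurableSpace Ω] {μ : Measure Ω} [IsProbabilityMeasure μ]
    {G : Ω → V → ℝ} (hG : Measurable G) {ν : Measure ℝ} [IsProbabilityMeasure ν]
    (hcdf : ∀ x : ℝ, ν (Set.Iic x) = ENNReal.ofReal (Real.exp (-Real.exp (-x))))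
    (hlaw : Measure.map G μ = Measure.pi (fun _ : V => ν)) (p : V → ℝ) (α : ℝ) (u : V) :
    ∫ ω, qArgmax p α (G ω) u ∂μ =
      Real.exp (α * Real.log (p u)) / ∑ v, Real.exp (α * Real.log (p v)) := by
  classical
  have hZ : 0 < ∑ v, Real.exp (α * Real.log (p v)) :=
    Finset.sum_pos (fun v _ => Real.exp_pos _) Finset.univ_nonempty
  have hle : ∀ u ∈ Finset.univ, ∫ ω, qArgmax p α (G ω) u ∂μ ≤
      Real.exp (α * Real.log (p u)) / ∑ v, Real.exp (α * Real.log (p v)) := by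
    intro u _
    let W : Set (V → ℝ) := {g | ∀ v, g v + α * Real.log (p v) ≤ g u + α * Real.log (p u)}
    have hW : MeasurableSet W := by
      simp only [W, Set.ofPred_forall]
      exact MeasurableSet.iInter fun v => measurableSet_le (by fun_prop) (by fun_prop)
    have hWm : μ.real (G ⁻¹' W) =
        Real.exp (α * Real.log (p u)) / ∑ v, Real.exp (α * Real.log (p v)) := by
      rw [measureReal_def, ← Measure.map_apply hG hW, hlaw,
        gumbel_max hcdf (fun v => α * Real.log (p v)) u, ENNReal.toReal_ofReal (by positivity)]
    rw [← hWm, ← integral_indicator_one (hG hW)]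
    refine integral_mono
      (integrable_simplex_coord hG (measurable_qArgmax p α) (qArgmax_mem_simplex p α) u)
      ((integrable_const (1 : ℝ)).indicator (hG hW)) fun ω => ?_
    by_cases h : u = argmaxOf (fun v => G ω v + α * Real.log (p v))
    · have hmem : ω ∈ G ⁻¹' W := by
        intro v
        have := argmaxOf_spec (fun v => G ω v + α * Real.log (p v)) v
        rwa [← h] at this
      simp [qArgmax, ← h, Set.indicator_of_mem hmem]
    · simp only [qArgmax, if_neg h]
      exact Set.indicator_nonneg (fun _ _ => zero_le_one) ω
  refine (Finset.sum_eq_sum_iff_of_le hle).1 ?_ u (Finset.mem_univ u)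
  rw [← Finset.sum_div, div_self hZ.ne']
  exact (integral_simplex_mem hG (measurable_qArgmax p α) (qArgmax_mem_simplex p α)).2


theorem stmt_11 {V : Type*} [Fintype V] [Nonempty V]
    {Ω : Type*} [MeasurableSpace Ω] (μ : Measure Ω) [IsProbabilityMeasure μ]
    (G : Ω → V → ℝ) (hG : Measurable G)
    (ν : Measure ℝ) [IsProbabilityMeasure ν]
    -- `ν` is the standard Gumbel law: CDF `F(x) = exp (−exp (−x))`
    (hcdf : ∀ x : ℝ, ν (Set.Iic x) = ENNReal.ofReal (Real.exp (-Real.exp (-x))))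
    -- the coordinates of `G` are i.i.d. with law `ν`
    (hlaw : Measure.map G μ = Measure.pi (fun _ : V => ν))
    (p : V → ℝ) (hp : p ∈ simplex V) (hppos : ∀ u, 0 < p u)
    (δ : ℝ) (hδ : 0 < δ) :
    -- `q*(g)_u = 1{u = argmax_v (g_v + (1/(1+δ)) log p_v)}` is measurable and
    -- simplex-valued
    Measurable (qArgmax p (1 / (1 + δ))) ∧
    (∀ g, qArgmax p (1 / (1 + δ)) g ∈ simplex V) ∧
    -- and it maximizes the penalized objective over all measurable
    -- simplex-valued sampling rules
    (∀ q : (V → ℝ) → V → ℝ, Measurable q → (∀ g, q g ∈ simplex V) →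
      (∫ ω, ∑ u, G ω u * q (G ω) u ∂μ) -
          (1 / δ) * KL (fun u => ∫ ω, q (G ω) u ∂μ) p ≤
        (∫ ω, ∑ u, G ω u * qArgmax p (1 / (1 + δ)) (G ω) u ∂μ) -
          (1 / δ) * KL (fun u => ∫ ω, qArgmax p (1 / (1 + δ)) (G ω) u ∂μ) p) := by
  refine ⟨measurable_qArgmax _ _, qArgmax_mem_simplex _ _, fun q hq hqs => ?_⟩
  have hGint : ∀ u, Integrable (fun ω => G ω u) μ := by
    intro u
    have hmp : MeasurePreserving (fun ω => G ω u) μ ν :=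
      (measurePreserving_eval (fun _ : V => ν) u).comp ⟨hG, hlaw⟩
    exact (hmp.integrable_comp measurable_id.aestronglyMeasurable).2 (integrable_id_gumbel hcdf)
  have hprod : ∀ s : (V → ℝ) → V → ℝ, Measurable s → (∀ g, s g ∈ simplex V) → ∀ u,
      Integrable (fun ω => G ω u * s (G ω) u) μ := by
    intro s hs hss u
    refine (hGint u).mul_bdd (c := 1) (measurable_pi_iff.1 (hs.comp hG) u).aestronglyMeasurable
      (Filter.Eventually.of_forall fun ω => ?_)
    rw [Real.norm_eq_abs, abs_of_nonneg ((hss _).1 u), ← (hss (G ω)).2]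
    exact Finset.single_le_sum (fun v _ => (hss _).1 v) (Finset.mem_univ u)
  have hlin : ∀ s : (V → ℝ) → V → ℝ, Measurable s → (∀ g, s g ∈ simplex V) →
      Integrable (fun ω => ∑ u, (G ω u + 1 / (1 + δ) * Real.log (p u)) * s (G ω) u) μ ∧
      ∫ ω, ∑ u, (G ω u + 1 / (1 + δ) * Real.log (p u)) * s (G ω) u ∂μ =
        (∫ ω, ∑ u, G ω u * s (G ω) u ∂μ) +
          ∑ u, 1 / (1 + δ) * Real.log (p u) * ∫ ω, s (G ω) u ∂μ := by
    intro s hs hss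
    have h1 : Integrable (fun ω => ∑ u, G ω u * s (G ω) u) μ :=
      integrable_finsetSum _ fun u _ => hprod s hs hss u
    have h2 : ∀ u, Integrable (fun ω => 1 / (1 + δ) * Real.log (p u) * s (G ω) u) μ :=
      fun u => (integrable_simplex_coord hG hs hss u).const_mul _
    have h3 := integrable_finsetSum Finset.univ fun u _ => h2 u
    simp only [add_mul, Finset.sum_add_distrib]
    refine ⟨h1.add h3, ?_⟩
    rw [integral_add h1 h3, integral_finsetSum _ fun u _ => h2 u]
    simp only [integral_const_mul]
  obtain ⟨hi, he⟩ := hlin q hq hqs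
  obtain ⟨hi', he'⟩ := hlin _ (measurable_qArgmax p (1 / (1 + δ)))
    (qArgmax_mem_simplex p (1 / (1 + δ)))
  have hmono := integral_mono hi hi' fun ω =>
    sum_mul_le_sum_mul_qArgmax p (1 / (1 + δ)) (G ω) (hqs (G ω))
  rw [he, he'] at hmono
  have hgibbs := sum_mul_add_KL_ge hppos hδ (fun _ => rfl)
    (integral_qArgmax_gumbel hG hcdf hlaw p (1 / (1 + δ)))
    (integral_simplex_mem (μ := μ) hG hq hqs)
  linarith
end
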